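/- arXiv:2407.16144 — 3 statements merged into one kernel-verified Lean document; each statement's English description precedes it below -/
import Mathlib

section
/- Let Q be the (n+m)×(n+m) block matrix [[Iₙ, −ηAᵀ], [ηA, Iₘ − η²AAᵀ]] and s = (−ηc, −ηb − 2η²Ac) ∈ ℝⁿ×ℝᵐ, so that one PDHG step on the unconstrained bilinear problem min_x max_y cᵀx − yᵀAx + bᵀy is the affine map z ↦ Qz + s. Let z̃⁰ = z⁰ ∈ ℝ^{n+m}, z̃ᵏ = Qz̃^{k−1} + s for k ≥ 1, and zᵏ⁺¹ = ((k+1)/(k+2))(Qzᵏ + s) + (1/(k+2))z⁰ for k ≥ 0. Then for every k ≥ 0, zᵏ = (1/(k+1))·Σ_{i=0}^{k} z̃ⁱ; i.e., Halpern PDHG coincides with averaged PDHG on unconstrained bilinear problems. -/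
open scoped BigOperators
open Matrix
noncomputable section

/-- For an affine map `z ↦ f z + s`, the Halpern iteration anchored at its starting point is the
running average of the fixed-point iteration. -/
theorem halpern_eq_average_of_affine {E : Type*} [AddCommGroup E] [Module ℝ E]
    (f : E →ₗ[ℝ] E) (s z0 : E) (zt z : ℕ → E)
    (hzt0 : zt 0 = z0) (hzt : ∀ k, zt (k + 1) = f (zt k) + s) (hz0 : z 0 = z0)
    (hz : ∀ k : ℕ, z (k + 1) =
      (((k : ℝ) + 1) / ((k : ℝ) + 2)) • (f (z k) + s) + (1 / ((k : ℝ) + 2)) • z0) (k : ℕ) :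
    z k = ((k : ℝ) + 1)⁻¹ • ∑ i ∈ Finset.range (k + 1), zt i := by
  induction k with
  | zero => simp [hz0, hzt0]
  | succ k ih =>
    have hsum : ∑ i ∈ Finset.range (k + 1 + 1), zt i =
        f (∑ i ∈ Finset.range (k + 1), zt i) + ((k : ℝ) + 1) • s + z0 := by
      rw [Finset.sum_range_succ', hzt0, map_sum]
      simp only [hzt, Finset.sum_add_distrib, Finset.sum_const, Finset.card_range]
      rw [← Nat.cast_smul_eq_nsmul ℝ]
      push_cast
      rfl
    have h1 : (k : ℝ) + 1 ≠ 0 := by positivity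
    have h2 : (k : ℝ) + 2 ≠ 0 := by positivity
    have h3 : (k : ℝ) + 1 + 1 ≠ 0 := by positivity
    rw [hz, ih, hsum, map_smul]
    push_cast
    match_scalars <;> field_simp <;> ring

/-- **Halpern PDHG = averaged PDHG on unconstrained bilinear problems.**
Let `Q` be the `(n+m)×(n+m)` block matrix `[[Iₙ, −ηAᵀ], [ηA, Iₘ − η²AAᵀ]]` and
`s = (−ηc, −ηb − 2η²Ac)`, so that one PDHG step on the unconstrained bilinear
problem is the affine map `z ↦ Qz + s`.  If `z̃⁰ = z⁰`, `z̃ᵏ = Qz̃^{k−1} + s`, and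
`zᵏ⁺¹ = ((k+1)/(k+2))(Qzᵏ + s) + (1/(k+2))z⁰`, then for every `k ≥ 0`,
`zᵏ = (1/(k+1))·Σ_{i=0}^{k} z̃ⁱ`. -/
theorem halpern_eq_average_on_bilinear (m n : ℕ)
    (A : Matrix (Fin m) (Fin n) ℝ) (b : Fin m → ℝ) (c : Fin n → ℝ)
    (η : ℝ) (hη : 0 < η)
    (Q : Matrix (Fin n ⊕ Fin m) (Fin n ⊕ Fin m) ℝ)
    (hQ : Q = Matrix.fromBlocks 1 (-(η • Aᵀ)) (η • A) (1 - (η ^ 2) • (A * Aᵀ)))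
    (s : Fin n ⊕ Fin m → ℝ)
    (hs : s = Sum.elim (-(η • c)) (-(η • b) - (2 * η ^ 2) • A.mulVec c))
    (z0 : Fin n ⊕ Fin m → ℝ)
    (zt : ℕ → Fin n ⊕ Fin m → ℝ)
    (hzt0 : zt 0 = z0)
    (hzt : ∀ k, zt (k + 1) = Q.mulVec (zt k) + s)
    (z : ℕ → Fin n ⊕ Fin m → ℝ)
    (hz0 : z 0 = z0)
    (hz : ∀ k : ℕ, z (k + 1) =
      (((k : ℝ) + 1) / ((k : ℝ) + 2)) • (Q.mulVec (z k) + s) + (1 / ((k : ℝ) + 2)) • z0) :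
    ∀ k : ℕ, z k = (((k : ℝ) + 1))⁻¹ • ∑ i ∈ Finset.range (k + 1), zt i := by
  exact halpern_eq_average_of_affine Q.mulVecLin s z0 zt z hzt0 hzt hz0 hz
end
end

section
/- If 0 < η ≤ 1/(2‖A‖₂), the PDHG operator is nonexpansive in the PDHG canonical norm: ‖T(z₁) − T(z₂)‖ ≤ ‖z₁ − z₂‖ for all z₁, z₂ ∈ ℝ^{n+m}. -/
open scoped BigOperators
open Matrix
noncomputable section

/-- The primal-dual space ℝⁿ × ℝᵐ. -/
abbrev PD (n m : ℕ) := (Fin n → ℝ) × (Fin m → ℝ)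

/-- Euclidean norm ‖z‖₂ of a primal-dual pair. -/
def enorm {n m : ℕ} (z : PD n m) : ℝ :=
  Real.sqrt (∑ i, (z.1 i) ^ 2 + ∑ j, (z.2 j) ^ 2)

/-- PDHG canonical norm ‖z‖ = √(zᵀ P_η z), with
`P_η = [[(1/η)Iₙ, −Aᵀ], [−A, (1/η)Iₘ]]`. -/
def cnorm {n m : ℕ} (A : Matrix (Fin m) (Fin n) ℝ) (η : ℝ) (z : PD n m) : ℝ :=
  Real.sqrt ((1 / η) * (∑ i, (z.1 i) ^ 2) + (1 / η) * (∑ j, (z.2 j) ^ 2)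
    - 2 * ∑ j, z.2 j * (A.mulVec z.1) j)

/-- Spectral norm ‖A‖₂ of a matrix (ℓ²→ℓ² operator norm). -/
def specNorm {n m : ℕ} (A : Matrix (Fin m) (Fin n) ℝ) : ℝ :=
  ‖LinearMap.toContinuousLinearMap (Matrix.toEuclideanLin A)‖

/-- Distance of `z` to the set `S`, measured with the norm–like function `N`. -/
def distN {n m : ℕ} (N : PD n m → ℝ) (z : PD n m) (S : Set (PD n m)) : ℝ :=
  sInf ((fun w => N (z - w)) '' S)

/-- One PDHG iteration `T(z)` for the LP `min_{x ≥ 0} cᵀx s.t. Ax = b`: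
`x⁺ = proj_{ℝⁿ₊}(x − ηAᵀy − ηc)`, `y⁺ = y + ηA(2x⁺ − x) − ηb`. -/
def pdhgT {n m : ℕ} (A : Matrix (Fin m) (Fin n) ℝ) (b : Fin m → ℝ) (c : Fin n → ℝ)
    (η : ℝ) (z : PD n m) : PD n m :=
  let x' : Fin n → ℝ := fun i => max 0 (z.1 i - η * (Aᵀ.mulVec z.2) i - η * c i)
  (x', fun j => z.2 j + η * (A.mulVec (fun i => 2 * x' i - z.1 i)) j - η * b j)

/-- Normal cone of the nonnegative orthant at `x` (empty unless `x ≥ 0`). -/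
def normalCone {n : ℕ} (x : Fin n → ℝ) : Set (Fin n → ℝ) :=
  {u | (∀ i, 0 ≤ x i) ∧ ∀ i, u i ≤ 0 ∧ u i * x i = 0}

/-- The subdifferential `F(x, y) = {(c + Aᵀy + u, b − Ax) : u ∈ N_{ℝⁿ₊}(x)}`. -/
def Fmap {n m : ℕ} (A : Matrix (Fin m) (Fin n) ℝ) (b : Fin m → ℝ) (c : Fin n → ℝ)
    (z : PD n m) : Set (PD n m) :=
  {w | ∃ u ∈ normalCone z.1,
      w = (fun i => c i + (Aᵀ.mulVec z.2) i + u i, fun j => b j - (A.mulVec z.1) j)}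

/-- The set `Z_L^*` built from an optimal solution `zs = (x*, y*)` and a radius `R`:
`{(x,y) : −A_Bᵀy ≤ c_B, Ax = b, x_{N∪B₂} ≥ 0, (1/R)(cᵀx + bᵀy) ≤ 0}` where
`N = {i : cᵢ + Aᵢᵀy* > 0}`, `B = {i : cᵢ + Aᵢᵀy* = 0}`,
`B₂ = {i : cᵢ + Aᵢᵀy* = 0, x*ᵢ = 0}`. -/
def ZLset {n m : ℕ} (A : Matrix (Fin m) (Fin n) ℝ) (b : Fin m → ℝ) (c : Fin n → ℝ)
    (R : ℝ) (zs : PD n m) : Set (PD n m) :=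
  {z | (∀ i, c i + (Aᵀ.mulVec zs.2) i = 0 → -(Aᵀ.mulVec z.2) i ≤ c i) ∧
       A.mulVec z.1 = b ∧
       (∀ i, (0 < c i + (Aᵀ.mulVec zs.2) i ∨
              (c i + (Aᵀ.mulVec zs.2) i = 0 ∧ zs.1 i = 0)) → 0 ≤ z.1 i) ∧
       (1 / R) * ((∑ i, c i * z.1 i) + ∑ j, b j * z.2 j) ≤ 0}

/-- The auxiliary PDHG operator `T̃` associated with the displacement vector
`v = (v_x, v_y)` (partition: `B = {i : (v_x)ᵢ > 0}`, rest of the indices):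
`x⁺_B = x_B − ηA_Bᵀy − ηc_B − (v_x)_B`,
`x⁺_{N₁∪N₂} = proj₊(x − ηAᵀy − ηc)_{N₁∪N₂} − (v_x)_{N₁∪N₂}`,
`y⁺ = y + ηA(2x⁺ − x) − ηb − v_y`. -/
def auxT {n m : ℕ} (A : Matrix (Fin m) (Fin n) ℝ) (b : Fin m → ℝ) (c : Fin n → ℝ)
    (η : ℝ) (v : PD n m) (z : PD n m) : PD n m :=
  let x' : Fin n → ℝ := fun i =>
    if 0 < v.1 i then z.1 i - η * (Aᵀ.mulVec z.2) i - η * c i - v.1 i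
    else max 0 (z.1 i - η * (Aᵀ.mulVec z.2) i - η * c i) - v.1 i
  (x', fun j => z.2 j + η * (A.mulVec (fun i => 2 * x' i - z.1 i)) j - η * b j - v.2 j)

/-- Cauchy–Schwarz for the bilinear form of a matrix, in terms of the spectral norm. -/
theorem abs_dotProduct_mulVec_le_specNorm {n m : ℕ} (A : Matrix (Fin m) (Fin n) ℝ)
    (x : Fin n → ℝ) (y : Fin m → ℝ) :
    |y ⬝ᵥ A *ᵥ x| ≤ specNorm A * (√(x ⬝ᵥ x) * √(y ⬝ᵥ y)) := by
  have norm_eq : ∀ {k : ℕ} (v : Fin k → ℝ), ‖WithLp.toLp 2 v‖ = √(v ⬝ᵥ v) := by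
    intro k v
    simp [EuclideanSpace.norm_eq, dotProduct, pow_two]
  have hop := (LinearMap.toContinuousLinearMap (Matrix.toEuclideanLin A)).le_opNorm
    (WithLp.toLp 2 x)
  have hcs := abs_real_inner_le_norm (WithLp.toLp 2 (A *ᵥ x)) (WithLp.toLp 2 y)
  simp only [LinearMap.coe_toContinuousLinearMap', Matrix.toLpLin_toLp] at hop
  have hinner : inner ℝ (WithLp.toLp 2 (A *ᵥ x)) (WithLp.toLp 2 y) = y ⬝ᵥ A *ᵥ x := by
    simp [EuclideanSpace.inner_eq_star_dotProduct]
  rw [hinner] at hcs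
  calc |y ⬝ᵥ A *ᵥ x| ≤ ‖WithLp.toLp 2 (A *ᵥ x)‖ * ‖WithLp.toLp 2 y‖ := hcs
    _ ≤ (specNorm A * ‖WithLp.toLp 2 x‖) * ‖WithLp.toLp 2 y‖ := by
      gcongr
      exact hop
    _ = specNorm A * (√(x ⬝ᵥ x) * √(y ⬝ᵥ y)) := by
      rw [norm_eq, norm_eq, mul_assoc]

/-- The matrix `η P_η` is positive semidefinite as soon as `η ‖A‖₂ ≤ 1`. -/
theorem two_mul_dotProduct_mulVec_le {n m : ℕ} (A : Matrix (Fin m) (Fin n) ℝ) {η : ℝ}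
    (hη : 0 ≤ η) (hA : η * specNorm A ≤ 1) (x : Fin n → ℝ) (y : Fin m → ℝ) :
    2 * η * (y ⬝ᵥ A *ᵥ x) ≤ x ⬝ᵥ x + y ⬝ᵥ y := by
  have hx : 0 ≤ x ⬝ᵥ x := Finset.sum_nonneg fun i _ => mul_self_nonneg (x i)
  have hy : 0 ≤ y ⬝ᵥ y := Finset.sum_nonneg fun j _ => mul_self_nonneg (y j)
  have h1 := mul_le_mul_of_nonneg_left
    ((le_abs_self _).trans (abs_dotProduct_mulVec_le_specNorm A x y)) hη
  have h2 := mul_le_mul_of_nonneg_right hA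
    (mul_nonneg (Real.sqrt_nonneg (x ⬝ᵥ x)) (Real.sqrt_nonneg (y ⬝ᵥ y)))
  nlinarith [sq_nonneg (√(x ⬝ᵥ x) - √(y ⬝ᵥ y)), Real.sq_sqrt hx, Real.sq_sqrt hy]

theorem cnorm_eq_sqrt_dotProduct {n m : ℕ} (A : Matrix (Fin m) (Fin n) ℝ) (η : ℝ)
    (z : PD n m) :
    cnorm A η z = √((1 / η) * (z.1 ⬝ᵥ z.1) + (1 / η) * (z.2 ⬝ᵥ z.2)
      - 2 * (z.2 ⬝ᵥ A *ᵥ z.1)) := by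
  simp [cnorm, dotProduct, pow_two]

/-- Projection onto the nonnegative half-line is firmly nonexpansive. -/
theorem max_zero_sub_mul_self_le (s t : ℝ) :
    (max 0 s - max 0 t) * (max 0 s - max 0 t) ≤ (max 0 s - max 0 t) * (s - t) := by
  rcases max_cases 0 s with ⟨hs, _⟩ | ⟨hs, _⟩ <;>
    rcases max_cases 0 t with ⟨ht, _⟩ | ⟨ht, _⟩ <;> rw [hs, ht] <;> nlinarith

/-- One step of a primal-dual iteration whose primal part is firmly nonexpansive decreases the
quadratic form of `P_η`. -/
theorem canonical_form_step_le {n m : ℕ} (A : Matrix (Fin m) (Fin n) ℝ) {η : ℝ}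
    (hη : 0 < η) (hA : η * specNorm A ≤ 1) (x u : Fin n → ℝ) (y w : Fin m → ℝ)
    (hu : u ⬝ᵥ u ≤ u ⬝ᵥ (x - η • (Aᵀ *ᵥ y)))
    (hw : w = y + η • (A *ᵥ (2 • u - x))) :
    (1 / η) * (u ⬝ᵥ u) + (1 / η) * (w ⬝ᵥ w) - 2 * (w ⬝ᵥ A *ᵥ u) ≤
      (1 / η) * (x ⬝ᵥ x) + (1 / η) * (y ⬝ᵥ y) - 2 * (y ⬝ᵥ A *ᵥ x) := by
  have hpsd := two_mul_dotProduct_mulVec_le A hη.le hA (x - u) (y - w)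
  have hadj : u ⬝ᵥ Aᵀ *ᵥ y = y ⬝ᵥ A *ᵥ u := by
    rw [Matrix.mulVec_transpose, dotProduct_comm, Matrix.dotProduct_mulVec]
  have scaled : u ⬝ᵥ u + w ⬝ᵥ w - 2 * η * (w ⬝ᵥ A *ᵥ u) ≤
      x ⬝ᵥ x + y ⬝ᵥ y - 2 * η * (y ⬝ᵥ A *ᵥ x) := by
    subst hw
    simp only [Matrix.mulVec_sub, two_smul, Matrix.mulVec_add, dotProduct_sub, sub_dotProduct,
      dotProduct_add, add_dotProduct, dotProduct_smul, smul_dotProduct, smul_eq_mul, hadj]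
      at hu hpsd ⊢
    rw [dotProduct_comm x u] at hpsd
    rw [dotProduct_comm (A *ᵥ x) y, dotProduct_comm (A *ᵥ u) y,
      dotProduct_comm (A *ᵥ x) (A *ᵥ u)] at *
    linarith
  calc _ = (1 / η) * (u ⬝ᵥ u + w ⬝ᵥ w - 2 * η * (w ⬝ᵥ A *ᵥ u)) := by field_simp
    _ ≤ (1 / η) * (x ⬝ᵥ x + y ⬝ᵥ y - 2 * η * (y ⬝ᵥ A *ᵥ x)) := by gcongr
    _ = _ := by field_simp

/-- **Nonexpansiveness of PDHG.** If `0 < η ≤ 1/(2‖A‖₂)`, then the PDHG operator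
is nonexpansive in the PDHG canonical norm:
`‖T(z₁) − T(z₂)‖ ≤ ‖z₁ − z₂‖` for all `z₁, z₂`. -/
theorem pdhg_nonexpansive (m n : ℕ)
    (A : Matrix (Fin m) (Fin n) ℝ) (b : Fin m → ℝ) (c : Fin n → ℝ)
    (η : ℝ) (hη1 : 0 < η) (hη2 : η ≤ 1 / (2 * specNorm A)) :
    ∀ z₁ z₂ : PD n m,
      cnorm A η (pdhgT A b c η z₁ - pdhgT A b c η z₂) ≤ cnorm A η (z₁ - z₂) := by
  intro z₁ z₂
  have hA : η * specNorm A ≤ 1 := by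
    have hnn : 0 ≤ specNorm A := norm_nonneg _
    have hpos : 0 < specNorm A := by
      refine hnn.lt_of_ne fun h => ?_
      rw [← h] at hη2
      norm_num at hη2
      linarith
    rw [le_div_iff₀ (by positivity)] at hη2
    linarith
  rw [cnorm_eq_sqrt_dotProduct, cnorm_eq_sqrt_dotProduct]
  refine Real.sqrt_le_sqrt (canonical_form_step_le A hη1 hA _ _ _ _ ?_ ?_)
  · refine Finset.sum_le_sum fun i _ => ?_
    have h := max_zero_sub_mul_self_le (z₁.1 i - η * (Aᵀ *ᵥ z₁.2) i - η * c i)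
      (z₂.1 i - η * (Aᵀ *ᵥ z₂.2) i - η * c i)
    refine h.trans (le_of_eq ?_)
    simp only [pdhgT, Prod.fst_sub, Prod.snd_sub, Pi.sub_apply, Pi.smul_apply, smul_eq_mul,
      Matrix.mulVec_sub]
    ring
  · have hfun : ∀ p q : Fin n → ℝ, (fun i => 2 * p i - q i) = 2 • p - q := by
      intro p q
      ext i
      simp
    ext j
    simp only [pdhgT, Prod.fst_sub, Prod.snd_sub, hfun, Pi.sub_apply, Pi.add_apply,
      Pi.smul_apply, smul_eq_mul, Matrix.mulVec_sub, two_smul, Matrix.mulVec_add]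
    ring
end
end

section
/- Let v = (v_x, v_y) satisfy v_x ≥ 0, Av_x = 0, A_Bᵀv_y = 0 (so (v_x)ᵢ = 0 for i ∈ N₁ ∪ N₂ and Aᵢᵀv_y > 0 for i ∈ N₂). Let z̃* = (x̃*, ỹ*) be a fixed point of the auxiliary operator T̃ with x̃*_{N₂} = 0 and with x̃*_B + (v_x)_B ≥ 0 componentwise. Then for every λ ≥ 0: T(z̃* + λv) − (z̃* + λv) = v; i.e., z̃* + λv lies in Z_v^* := {z : T(z) − z = v}. -/
open scoped BigOperators
open Matrix
noncomputable section

/-- **Rays of fixed displacement (Lemma 10, part (iii)).** Let `v = (v_x, v_y)`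
satisfy `v_x ≥ 0`, `Av_x = 0`, `A_Bᵀv_y = 0` (with `(Aᵀv_y)ᵢ ≥ 0` wherever
`(v_x)ᵢ = 0`, so `B, N₁, N₂` partition the indices).  Let `z̃*` be a fixed
point of the auxiliary operator `T̃` with `x̃*_{N₂} = 0` and
`x̃*_B + (v_x)_B ≥ 0` componentwise.  Then for every `λ ≥ 0`:
`T(z̃* + λv) − (z̃* + λv) = v`. -/
theorem aux_fixed_point_ray_in_Zv (m n : ℕ)
    (A : Matrix (Fin m) (Fin n) ℝ) (b : Fin m → ℝ) (c : Fin n → ℝ)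
    (η : ℝ) (hη : 0 < η)
    (vx : Fin n → ℝ) (vy : Fin m → ℝ)
    (hvx : ∀ i, 0 ≤ vx i) (hAvx : A.mulVec vx = 0)
    (hBv : ∀ i, 0 < vx i → (Aᵀ.mulVec vy) i = 0)
    (hsign : ∀ i, vx i = 0 → 0 ≤ (Aᵀ.mulVec vy) i)
    (zt : PD n m) (hfix : auxT A b c η (vx, vy) zt = zt)
    (hN2 : ∀ i, vx i = 0 → 0 < (Aᵀ.mulVec vy) i → zt.1 i = 0)
    (hnonneg : ∀ i, 0 < vx i → 0 ≤ zt.1 i + vx i) :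
    ∀ lam : ℝ, 0 ≤ lam →
      pdhgT A b c η (zt + lam • ((vx, vy) : PD n m))
        - (zt + lam • ((vx, vy) : PD n m)) = ((vx, vy) : PD n m) := by
  obtain ⟨x, y⟩ := zt
  intro lam hlam
  have hx := congrArg Prod.fst hfix
  have hy := congrArg Prod.snd hfix
  simp only [auxT] at hx hy hN2 hnonneg
  have htranspose : ∀ i, (Aᵀ *ᵥ (y + lam • vy)) i = (Aᵀ *ᵥ y) i + lam * (Aᵀ *ᵥ vy) i := by
    intro i
    simp [mulVec_add, mulVec_smul]
  have hprimal : ∀ i, max 0 ((x + lam • vx) i - η * (Aᵀ *ᵥ (y + lam • vy)) i - η * c i) =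
      x i + lam * vx i + vx i := by
    intro i
    have hi := congrFun hx i
    simp only [htranspose, Pi.add_apply, Pi.smul_apply, smul_eq_mul]
    rcases (hvx i).lt_or_eq with h | h
    · rw [if_pos h] at hi
      rw [hBv i h, max_eq_right]
      · linarith
      · nlinarith [hnonneg i h, mul_nonneg hlam (hvx i)]
    · rw [if_neg h.not_lt] at hi
      rw [← h] at hi ⊢
      rcases (hsign i h.symm).lt_or_eq with h' | h'
      · have hxi := hN2 i h.symm h'
        have hle := le_max_right 0 (x i - η * (Aᵀ *ᵥ y) i - η * c i)
        rw [max_eq_left]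
        · linarith
        · nlinarith [mul_nonneg hη.le (mul_nonneg hlam h'.le)]
      · rw [← h']
        simpa using hi
  have hextrap : A *ᵥ (fun i => 2 * (x i + lam * vx i + vx i) - (x + lam • vx) i) = A *ᵥ x := by
    have : (fun i => 2 * (x i + lam * vx i + vx i) - (x + lam • vx) i) =
        x + (lam + 2) • vx := by
      ext i
      simp only [Pi.add_apply, Pi.smul_apply, smul_eq_mul]
      ring
    rw [this, mulVec_add, mulVec_smul, hAvx, smul_zero, add_zero]
  have hself : (fun i => 2 * x i - x i) = x := by
    ext i
    ring
  simp only [congrFun hx, hself] at hy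
  refine Prod.ext ?_ ?_
  · ext i
    simp only [pdhgT, Prod.fst_sub, Prod.fst_add, Prod.snd_add, Prod.smul_fst, Prod.smul_snd,
      Pi.sub_apply, hprimal]
    simp only [Pi.add_apply, Pi.smul_apply, smul_eq_mul]
    ring
  · ext j
    have hj := congrFun hy j
    simp only [pdhgT, Prod.snd_sub, Prod.fst_add, Prod.snd_add, Prod.smul_fst, Prod.smul_snd,
      Pi.sub_apply, hprimal, hextrap]
    linarith
end
end
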